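/- Let V : ℝ^N → [0,∞) be lower semicontinuous and assume that for every x ∈ ℝ^N∖{0} and every (p,Y) ∈ J^{2,−}V(x) there exists ᾱ ∈ A with σ(x,ᾱ)^T p = 0 and −p·f(x,ᾱ) − trace(a(x,ᾱ)Y) ≥ 0. Fix μ > 0, let K := {x : V(x) ≤ μ} (a closed set), and let C : ℝ^N → ℝ be the indicator C(x) = 0 for x ∈ K and C(x) = 1 for x ∉ K. Then C is a viscosity supersolution of max_{α∈A}{ −Du·f(x,α) − trace(a(x,α)D²u) } = 0 on ℝ^N∖{0}, i.e. for every x ≠ 0 and every (p,Y) ∈ J^{2,−}C(x), sup_{α∈A}{ −p·f(x,α) − trace(a(x,α)Y) } ≥ 0. -/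

import Mathlib

open scoped BigOperators

noncomputable section

/-- Euclidean dot product on `ℝ^N`. -/
def dotP {N : ℕ} (p q : EuclideanSpace ℝ (Fin N)) : ℝ := ∑ i, p i * q i

/-- Quadratic form `v ⬝ (Y v)` of an `N × N` matrix. -/
def quadF {N : ℕ} (Y : Matrix (Fin N) (Fin N) ℝ) (v : EuclideanSpace ℝ (Fin N)) : ℝ :=
  ∑ i, v i * ∑ j, Y i j * v j

/-- Second-order subjet `J^{2,-}V(x)`: pairs `(p,Y)` with `Y` symmetric such that
`V(y) ≥ V(x) + p·(y-x) + (1/2)(y-x)·Y(y-x) + o(|y-x|²)` as `y → x`. -/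
def InSubjet {N : ℕ} (V : EuclideanSpace ℝ (Fin N) → ℝ)
    (x p : EuclideanSpace ℝ (Fin N)) (Y : Matrix (Fin N) (Fin N) ℝ) : Prop :=
  Y.IsSymm ∧ ∀ ε > 0, ∃ δ > 0, ∀ y : EuclideanSpace ℝ (Fin N), ‖y - x‖ < δ →
    V y ≥ V x + dotP p (y - x) + (1/2) * quadF Y (y - x) - ε * ‖y - x‖ ^ 2

/-- The diffusion matrix `a = (1/2) σ σᵀ`. -/
def aMat {N M : ℕ} (σ : Matrix (Fin N) (Fin M) ℝ) : Matrix (Fin N) (Fin N) ℝ :=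
  (1/2 : ℝ) • (σ * σ.transpose)

open Filter Topology

lemma dotP_eq_dotProduct {N : ℕ} (p q : EuclideanSpace ℝ (Fin N)) :
    dotP p q = p.ofLp ⬝ᵥ q.ofLp := rfl

lemma quadF_eq_dotProduct {N : ℕ} (Y : Matrix (Fin N) (Fin N) ℝ)
    (v : EuclideanSpace ℝ (Fin N)) : quadF Y v = v.ofLp ⬝ᵥ Y.mulVec v.ofLp := rfl

lemma dotP_smul_left {N : ℕ} (t : ℝ) (p q : EuclideanSpace ℝ (Fin N)) :
    dotP (t • p) q = t * dotP p q := by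
  simp only [dotP_eq_dotProduct, WithLp.ofLp_smul, smul_dotProduct, smul_eq_mul]

lemma continuous_dotP {N : ℕ} (p : EuclideanSpace ℝ (Fin N)) : Continuous (dotP p) := by
  unfold dotP
  fun_prop

lemma continuous_quadF {N : ℕ} (Y : Matrix (Fin N) (Fin N) ℝ) : Continuous (quadF Y) := by
  unfold quadF
  fun_prop

lemma abs_quadF_le {N : ℕ} (Y : Matrix (Fin N) (Fin N) ℝ) (v : EuclideanSpace ℝ (Fin N)) :
    |quadF Y v| ≤ (∑ i, ∑ j, |Y i j|) * ‖v‖ ^ 2 := by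
  have hcoord : ∀ i, |v i| ≤ ‖v‖ := fun i => by
    simpa using PiLp.norm_apply_le v i
  unfold quadF
  simp only [Finset.mul_sum, Finset.sum_mul]
  refine (Finset.abs_sum_le_sum_abs _ _).trans (Finset.sum_le_sum fun i _ => ?_)
  refine (Finset.abs_sum_le_sum_abs _ _).trans (Finset.sum_le_sum fun j _ => ?_)
  rw [abs_mul, abs_mul]
  have := mul_le_mul (hcoord i) (hcoord j) (abs_nonneg _) (norm_nonneg v)
  nlinarith [abs_nonneg (Y i j), mul_le_mul_of_nonneg_left this (abs_nonneg (Y i j))]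

/-- The quadratic polynomial centred at `x` with gradient `p` and Hessian `Z` at `x`. -/
def quadPoly {N : ℕ} (x p : EuclideanSpace ℝ (Fin N)) (Z : Matrix (Fin N) (Fin N) ℝ)
    (y : EuclideanSpace ℝ (Fin N)) : ℝ :=
  dotP p (y - x) + (1/2) * quadF Z (y - x)

/-- The gradient of `quadPoly x p Z` at `z`. -/
def quadPolyGrad {N : ℕ} (x p : EuclideanSpace ℝ (Fin N)) (Z : Matrix (Fin N) (Fin N) ℝ)
    (z : EuclideanSpace ℝ (Fin N)) : EuclideanSpace ℝ (Fin N) :=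
  WithLp.toLp 2 (p.ofLp + Z.mulVec (z - x).ofLp)

lemma continuous_quadPoly {N : ℕ} (x p : EuclideanSpace ℝ (Fin N))
    (Z : Matrix (Fin N) (Fin N) ℝ) : Continuous (quadPoly x p Z) :=
  ((continuous_dotP p).comp (continuous_id.sub continuous_const)).add
    (continuous_const.mul ((continuous_quadF Z).comp (continuous_id.sub continuous_const)))

lemma quadPoly_self {N : ℕ} (x p : EuclideanSpace ℝ (Fin N)) (Z : Matrix (Fin N) (Fin N) ℝ) :
    quadPoly x p Z x = 0 := by
  simp [quadPoly, dotP, quadF]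

lemma quadPoly_eq_add {N : ℕ} (x p : EuclideanSpace ℝ (Fin N)) {Z : Matrix (Fin N) (Fin N) ℝ}
    (hZ : Z.IsSymm) (z y : EuclideanSpace ℝ (Fin N)) :
    quadPoly x p Z y = quadPoly x p Z z + dotP (quadPolyGrad x p Z z) (y - z)
      + (1/2) * quadF Z (y - z) := by
  obtain ⟨u, rfl⟩ : ∃ u, z = x + u := ⟨z - x, by abel⟩
  obtain ⟨v, rfl⟩ : ∃ v, y = x + u + v := ⟨y - (x + u), by abel⟩
  have h1 : x + u + v - x = u + v := by abel
  have h2 : x + u - x = u := by abel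
  have h3 : x + u + v - (x + u) = v := by abel
  have hs : u.ofLp ⬝ᵥ Z.mulVec v.ofLp = v.ofLp ⬝ᵥ Z.mulVec u.ofLp := by
    rw [Matrix.dotProduct_mulVec, ← Matrix.mulVec_transpose, hZ.eq, dotProduct_comm]
  simp only [quadPoly, quadPolyGrad, dotP_eq_dotProduct, quadF_eq_dotProduct, h1, h2, h3,
    WithLp.ofLp_add, Matrix.mulVec_add, dotProduct_add, add_dotProduct, hs,
    dotProduct_comm (Z.mulVec u.ofLp) v.ofLp]
  ring

lemma quadPoly_sub_smul_one {N : ℕ} (x p : EuclideanSpace ℝ (Fin N))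
    (Y : Matrix (Fin N) (Fin N) ℝ) (ε : ℝ) (y : EuclideanSpace ℝ (Fin N)) :
    quadPoly x p (Y - (2 * ε) • (1 : Matrix (Fin N) (Fin N) ℝ)) y
      = quadPoly x p Y y - ε * ‖y - x‖ ^ 2 := by
  have hn : (y - x).ofLp ⬝ᵥ (y - x).ofLp = ‖y - x‖ ^ 2 := by
    rw [EuclideanSpace.real_norm_sq_eq]
    simp [dotProduct, sq]
  simp only [quadPoly, quadF_eq_dotProduct, Matrix.sub_mulVec, Matrix.smul_mulVec,
    Matrix.one_mulVec, dotProduct_sub, dotProduct_smul, hn, smul_eq_mul]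
  ring

lemma quadF_smul_sub_vecMulVec {N : ℕ} (Z : Matrix (Fin N) (Fin N) ℝ)
    (q v : EuclideanSpace ℝ (Fin N)) (t c : ℝ) :
    quadF (t • (Z - c • Matrix.vecMulVec q.ofLp q.ofLp)) v
      = t * (quadF Z v - c * dotP q v ^ 2) := by
  simp only [dotP_eq_dotProduct, quadF_eq_dotProduct, Matrix.sub_mulVec, Matrix.smul_mulVec,
    Matrix.vecMulVec_mulVec, dotProduct_sub, dotProduct_smul, smul_eq_mul,
    op_smul_eq_smul, dotProduct_comm v.ofLp q.ofLp]
  ring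

/-- A local minimum point of `V + exp (-L φ) / L`, with `φ` a quadratic polynomial, yields an
element of the subjet of `V` whose gradient is a positive multiple of that of `φ`. -/
lemma inSubjet_of_isLocalMin {N : ℕ} {V : EuclideanSpace ℝ (Fin N) → ℝ}
    {x p z : EuclideanSpace ℝ (Fin N)} {Z : Matrix (Fin N) (Fin N) ℝ} (hZ : Z.IsSymm)
    {L : ℝ} (hL : 0 < L)
    (hz : IsLocalMin (fun y => V y + Real.exp (-(L * quadPoly x p Z y)) / L) z) :
    InSubjet V z (Real.exp (-(L * quadPoly x p Z z)) • quadPolyGrad x p Z z)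
      (Real.exp (-(L * quadPoly x p Z z)) • (Z - (4 * L) •
        Matrix.vecMulVec (quadPolyGrad x p Z z).ofLp (quadPolyGrad x p Z z).ofLp)) := by
  set t := Real.exp (-(L * quadPoly x p Z z)) with ht
  set q := quadPolyGrad x p Z z
  have htpos : 0 < t := Real.exp_pos _
  refine ⟨?_, fun ε hε => ?_⟩
  · have : (Matrix.vecMulVec q.ofLp q.ofLp).IsSymm := by
      simp [Matrix.IsSymm, Matrix.transpose_vecMulVec]
    exact (hZ.sub (this.smul _)).smul _
  set B := ∑ i, ∑ j, |Z i j| with hB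
  have hcont : Continuous fun y => L * (quadPoly x p Z y - quadPoly x p Z z) :=
    continuous_const.mul ((continuous_quadPoly x p Z).sub continuous_const)
  have hsmall : ∀ᶠ y in 𝓝 z, |L * (quadPoly x p Z y - quadPoly x p Z z)| < 1 := by
    have := hcont.abs.tendsto z
    simp only [sub_self, mul_zero, abs_zero] at this
    exact this.eventually (gt_mem_nhds one_pos)
  have hrem : ∀ᶠ y in 𝓝 z, t * (L / 2) * B ^ 2 * ‖y - z‖ ^ 2 < ε := by
    have hc : Continuous fun y : EuclideanSpace ℝ (Fin N) =>
        t * (L / 2) * B ^ 2 * ‖y - z‖ ^ 2 := by fun_prop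
    have := hc.tendsto z
    simp only [sub_self, norm_zero, ne_eq, OfNat.ofNat_ne_zero, not_false_eq_true, zero_pow,
      mul_zero] at this
    exact this.eventually (gt_mem_nhds hε)
  obtain ⟨δ, hδ, H⟩ := Metric.eventually_nhds_iff.1 ((hz.and hsmall).and hrem)
  refine ⟨δ, hδ, fun y hy => ?_⟩
  obtain ⟨⟨hmin, hs⟩, hr⟩ := H (by rwa [dist_eq_norm] : dist y z < δ)
  set s := quadPoly x p Z y - quadPoly x p Z z with hsdef
  have hsexp : s = dotP q (y - z) + (1/2) * quadF Z (y - z) := by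
    rw [hsdef, quadPoly_eq_add x p hZ z y]; ring
  have hexp : Real.exp (-(L * quadPoly x p Z y)) = t * Real.exp (-(L * s)) := by
    rw [ht, ← Real.exp_add, hsdef]; congr 1; ring
  have hbound : Real.exp (-(L * s)) ≤ 1 - L * s + (L * s) ^ 2 := by
    have h := Real.abs_exp_sub_one_sub_id_le (x := -(L * s)) (by rw [abs_neg]; exact hs.le)
    have := (abs_le.1 h).2
    nlinarith
  have hV : V y ≥ V z + t * (s - L * s ^ 2) := by
    have h1 : t * Real.exp (-(L * s)) / L ≤ t / L - t * (s - L * s ^ 2) := by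
      rw [div_le_iff₀ hL]
      have := mul_le_mul_of_nonneg_left hbound htpos.le
      have h2 : t / L * L = t := div_mul_cancel₀ _ hL.ne'
      nlinarith
    simp only [hexp, ← ht] at hmin
    linarith
  have hQ := abs_quadF_le Z (y - z)
  rw [← hB] at hQ
  rw [dotP_smul_left, quadF_smul_sub_vecMulVec]
  set D := dotP q (y - z)
  set Q := quadF Z (y - z)
  have hs2 : s ^ 2 ≤ 2 * D ^ 2 + Q ^ 2 / 2 := by
    rw [hsexp]; nlinarith [sq_nonneg (D - 1/2 * Q)]
  have hQ2 : Q ^ 2 ≤ B ^ 2 * ‖y - z‖ ^ 2 * ‖y - z‖ ^ 2 := by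
    have := sq_le_sq' (abs_le.1 hQ).1 (abs_le.1 hQ).2
    linarith [this, (by ring : (B * ‖y - z‖ ^ 2) ^ 2 = B ^ 2 * ‖y - z‖ ^ 2 * ‖y - z‖ ^ 2)]
  have hrem' : t * (L / 2) * Q ^ 2 ≤ ε * ‖y - z‖ ^ 2 := by
    have h1 := mul_le_mul_of_nonneg_left hQ2 (by positivity : 0 ≤ t * (L / 2))
    have h2 := mul_le_mul_of_nonneg_right hr.le (sq_nonneg ‖y - z‖)
    linarith
  have h3 := mul_le_mul_of_nonneg_left hs2 (by positivity : 0 ≤ t * L)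
  have h4 : t * (s - L * s ^ 2) = t * (D + 1/2 * Q) - t * L * s ^ 2 := by rw [hsexp]; ring
  linarith

/-- If `φ` is negative, away from `x`, on the sublevel set `{V ≤ V x}`, then for large `L` the
function `V + exp (-L φ) / L` has a local minimum arbitrarily close to `x`. -/
lemma exists_isLocalMin_add_exp {E : Type*} [NormedAddCommGroup E] [ProperSpace E]
    {V : E → ℝ} (hV0 : ∀ x, 0 ≤ V x) (hlsc : LowerSemicontinuous V) {φ : E → ℝ}
    (hφ : Continuous φ) {x : E} (hφx : φ x = 0) {r c : ℝ} (hr : 0 < r) (hc : 0 < c)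
    (hneg : ∀ y, ‖y - x‖ = r → V y ≤ V x → φ y < -c) :
    ∃ L > 0, ∃ z, ‖z - x‖ < r ∧ IsLocalMin (fun y => V y + Real.exp (-(L * φ y)) / L) z := by
  have hS : IsCompact (Metric.sphere x r ∩ {y | -c ≤ φ y}) :=
    (isCompact_sphere x r).inter_right (isClosed_le continuous_const hφ)
  obtain ⟨m, hm, hmS⟩ : ∃ m > V x, ∀ y, ‖y - x‖ = r → -c ≤ φ y → m ≤ V y := by
    rcases (Metric.sphere x r ∩ {y | -c ≤ φ y}).eq_empty_or_nonempty with h | h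
    · refine ⟨V x + 1, by linarith, fun y hy hy' => ?_⟩
      have : y ∈ Metric.sphere x r ∩ {y | -c ≤ φ y} := ⟨by simpa [dist_eq_norm] using hy, hy'⟩
      simp [h] at this
    · obtain ⟨w, hw, hwmin⟩ := (hlsc.lowerSemicontinuousOn _).exists_isMinOn h hS
      refine ⟨V w, ?_, fun y hy hy' => hwmin ⟨by simpa [dist_eq_norm] using hy, hy'⟩⟩
      by_contra hcon
      have := hneg w (by simpa [dist_eq_norm] using hw.1) (not_lt.1 hcon)
      exact absurd hw.2 (by simpa using this)
  obtain ⟨L, hL0, hL1, hL2⟩ : ∃ L > 0, 1 / L < m - V x ∧ V x < L * (c ^ 2 / 2) := by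
    have h1 : ∀ᶠ L : ℝ in atTop, 1 / L < m - V x := by
      have := tendsto_inv_atTop_zero (𝕜 := ℝ)
      simpa using this.eventually (gt_mem_nhds (sub_pos.2 hm))
    have h2 : ∀ᶠ L : ℝ in atTop, V x < L * (c ^ 2 / 2) :=
      (tendsto_id.atTop_mul_const (by positivity : 0 < c ^ 2 / 2)).eventually_gt_atTop _
    obtain ⟨L, h⟩ := ((eventually_gt_atTop (0 : ℝ)).and (h1.and h2)).exists
    exact ⟨L, h.1, h.2.1, h.2.2⟩
  have hFlsc : LowerSemicontinuous fun y => V y + Real.exp (-(L * φ y)) / L :=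
    hlsc.add (by fun_prop : Continuous fun y => Real.exp (-(L * φ y)) / L).lowerSemicontinuous
  obtain ⟨z, hz, hzmin⟩ := (hFlsc.lowerSemicontinuousOn (Metric.closedBall x r)).exists_isMinOn
    ⟨x, Metric.mem_closedBall_self hr.le⟩ (isCompact_closedBall x r)
  have hzx : V z + Real.exp (-(L * φ z)) / L ≤ V x + 1 / L := by
    have := hzmin (Metric.mem_closedBall_self hr.le)
    simpa [hφx] using this
  have hzr : ‖z - x‖ < r := by
    refine lt_of_le_of_ne (by simpa [dist_eq_norm] using hz) fun heq => ?_
    by_cases hzc : -c ≤ φ z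
    · have := hmS z heq hzc
      have : 0 < Real.exp (-(L * φ z)) / L := by positivity
      linarith
    · have h1 : Real.exp (L * c) ≤ Real.exp (-(L * φ z)) := by
        apply Real.exp_le_exp.2
        nlinarith [not_le.1 hzc]
      have h2 := Real.quadratic_le_exp_of_nonneg (by positivity : 0 ≤ L * c)
      have h3 : 1 / L + c + L * (c ^ 2 / 2) ≤ Real.exp (-(L * φ z)) / L := by
        rw [le_div_iff₀ hL0]
        have : 1 / L * L = 1 := div_mul_cancel₀ _ hL0.ne'
        nlinarith
      linarith [hV0 z]
  refine ⟨L, hL0, z, hzr, ?_⟩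
  exact hzmin.isLocalMin (Filter.mem_of_superset
    (Metric.isOpen_ball.mem_nhds (by simpa [dist_eq_norm] using hzr)) Metric.ball_subset_closedBall)

lemma trace_aMat_mul_smul_sub_vecMulVec {N M : ℕ} {S : Matrix (Fin N) (Fin M) ℝ}
    {q : Fin N → ℝ} (hq : S.transpose.mulVec q = 0) (Z : Matrix (Fin N) (Fin N) ℝ) (t c : ℝ) :
    (aMat S * (t • (Z - c • Matrix.vecMulVec q q))).trace = t * (aMat S * Z).trace := by
  have h : aMat S * Matrix.vecMulVec q q = 0 := by
    rw [aMat, Matrix.smul_mul, Matrix.mul_assoc, Matrix.mul_vecMulVec, hq]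
    simp
  rw [Matrix.mul_smul, Matrix.mul_sub, Matrix.mul_smul, h]
  simp

/-- A pair that is a second-order upper bound for `{V ≤ V x}` at `x` is approximated by pairs at
which the supersolution inequality holds. -/
lemma exists_near_supersolution {N M : ℕ} {A : Type*}
    {f : EuclideanSpace ℝ (Fin N) → A → EuclideanSpace ℝ (Fin N)}
    {σ : EuclideanSpace ℝ (Fin N) → A → Matrix (Fin N) (Fin M) ℝ}
    {V : EuclideanSpace ℝ (Fin N) → ℝ} (hV0 : ∀ x, 0 ≤ V x) (hlsc : LowerSemicontinuous V)
    (hV : ∀ x : EuclideanSpace ℝ (Fin N), x ≠ 0 → ∀ p Y, InSubjet V x p Y →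
      ∃ α : A, (σ x α).transpose.mulVec (fun i => p i) = 0 ∧
        0 ≤ -dotP p (f x α) - (aMat (σ x α) * Y).trace)
    {x p : EuclideanSpace ℝ (Fin N)} (hx : x ≠ 0) {Y : Matrix (Fin N) (Fin N) ℝ}
    (hY : Y.IsSymm)
    (hsub : ∀ ε > 0, ∃ δ > 0, ∀ y, ‖y - x‖ < δ → V y ≤ V x →
      quadPoly x p Y y ≤ ε * ‖y - x‖ ^ 2) {ε : ℝ} (hε : 0 < ε) :
    ∃ z, ‖z - x‖ < ε ∧ ∃ α,
      0 ≤ -dotP (quadPolyGrad x p (Y - (2 * ε) • (1 : Matrix (Fin N) (Fin N) ℝ)) z) (f z α)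
        - (aMat (σ z α) * (Y - (2 * ε) • (1 : Matrix (Fin N) (Fin N) ℝ))).trace := by
  set Z := Y - (2 * ε) • (1 : Matrix (Fin N) (Fin N) ℝ) with hZdef
  have hZ : Z.IsSymm := hY.sub (Matrix.isSymm_one.smul _)
  obtain ⟨δ, hδ, H⟩ := hsub (ε / 2) (by positivity)
  obtain ⟨r, hr, hr'⟩ := exists_between (lt_min hδ (lt_min hε (norm_pos_iff.2 hx)))
  obtain ⟨hrδ, hrε, hrx⟩ : r < δ ∧ r < ε ∧ r < ‖x‖ := by simpa using hr'
  obtain ⟨L, hL, z, hzr, hz⟩ := exists_isLocalMin_add_exp hV0 hlsc (continuous_quadPoly x p Z)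
    (quadPoly_self x p Z) hr (by positivity : 0 < ε * r ^ 2 / 4) (fun y hy hVy => by
      have := H y (hy ▸ hrδ) hVy
      rw [hZdef, quadPoly_sub_smul_one]
      rw [hy] at this ⊢
      have : 0 < ε * r ^ 2 := by positivity
      linarith)
  have hz0 : z ≠ 0 := by
    rintro rfl
    rw [zero_sub, norm_neg] at hzr
    exact lt_asymm hzr hrx
  obtain ⟨α, hα, hα'⟩ := hV z hz0 _ _ (inSubjet_of_isLocalMin hZ hL hz)
  refine ⟨z, hzr.trans hrε, α, ?_⟩
  set t := Real.exp (-(L * quadPoly x p Z z))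
  have htpos : 0 < t := Real.exp_pos _
  set q := quadPolyGrad x p Z z
  have hq : (σ z α).transpose.mulVec q.ofLp = 0 := by
    have h : (σ z α).transpose.mulVec (t • q.ofLp) = 0 := hα
    rw [Matrix.mulVec_smul] at h
    exact (smul_eq_zero.1 h).resolve_left htpos.ne'
  rw [trace_aMat_mul_smul_sub_vecMulVec hq, dotP_smul_left] at hα'
  refine nonneg_of_mul_nonneg_right (a := t) ?_ htpos
  linarith

/-- under the constrained HJB supersolution condition on a l.s.c. nonnegative `V`,
the indicator `C` of the sublevel set `K = {V ≤ μ}` (`C = 0` on `K`, `C = 1` off `K`) is a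
viscosity supersolution of `max_α { -Du·f - trace(a D²u) } = 0` on `ℝ^N \ {0}`. -/
theorem stmt3 {N M : ℕ} {A : Type*} [MetricSpace A] [CompactSpace A] [Nonempty A]
    (f : EuclideanSpace ℝ (Fin N) → A → EuclideanSpace ℝ (Fin N))
    (σ : EuclideanSpace ℝ (Fin N) → A → Matrix (Fin N) (Fin M) ℝ)
    (hf : Continuous fun q : EuclideanSpace ℝ (Fin N) × A => f q.1 q.2)
    (hσ : Continuous fun q : EuclideanSpace ℝ (Fin N) × A => σ q.1 q.2)
    (V : EuclideanSpace ℝ (Fin N) → ℝ) (hV0 : ∀ x, 0 ≤ V x)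
    (hlsc : LowerSemicontinuous V)
    (hV : ∀ x : EuclideanSpace ℝ (Fin N), x ≠ 0 → ∀ p Y, InSubjet V x p Y →
      ∃ α : A, (σ x α).transpose.mulVec (fun i => p i) = 0 ∧
        0 ≤ -dotP p (f x α) - (aMat (σ x α) * Y).trace)
    (μ : ℝ) (hμ : 0 < μ) (C : EuclideanSpace ℝ (Fin N) → ℝ)
    (hC0 : ∀ x, V x ≤ μ → C x = 0) (hC1 : ∀ x, ¬ V x ≤ μ → C x = 1) :
    ∀ x : EuclideanSpace ℝ (Fin N), x ≠ 0 → ∀ p Y, InSubjet C x p Y →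
      0 ≤ ⨆ α : A, (-dotP p (f x α) - (aMat (σ x α) * Y).trace) := by
  intro x hx p Y hpY
  have hsub : ∀ ε > 0, ∃ δ > 0, ∀ y, ‖y - x‖ < δ → V y ≤ V x →
      quadPoly x p Y y ≤ ε * ‖y - x‖ ^ 2 := fun ε hε => by
    obtain ⟨δ, hδ, H⟩ := hpY.2 ε hε
    refine ⟨δ, hδ, fun y hy hVy => ?_⟩
    have hC : C y ≤ C x := by
      by_cases hxμ : V x ≤ μ
      · rw [hC0 x hxμ, hC0 y (hVy.trans hxμ)]
      · rw [hC1 x hxμ]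
        by_cases hyμ : V y ≤ μ
        · rw [hC0 y hyμ]; exact zero_le_one
        · rw [hC1 y hyμ]
    have := H y hy
    unfold quadPoly
    linarith
  let G : ℝ × EuclideanSpace ℝ (Fin N) × A → ℝ := fun w =>
    -dotP (quadPolyGrad x p (Y - (2 * w.1) • (1 : Matrix (Fin N) (Fin N) ℝ)) w.2.1)
        (f w.2.1 w.2.2)
      - (aMat (σ w.2.1 w.2.2) * (Y - (2 * w.1) • (1 : Matrix (Fin N) (Fin N) ℝ))).trace
  have hG : Continuous G := by
    have hf' : Continuous fun w : ℝ × EuclideanSpace ℝ (Fin N) × A => f w.2.1 w.2.2 :=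
      hf.comp continuous_snd
    have hσ' : Continuous fun w : ℝ × EuclideanSpace ℝ (Fin N) × A => σ w.2.1 w.2.2 :=
      hσ.comp continuous_snd
    have hY' : Continuous fun w : ℝ × EuclideanSpace ℝ (Fin N) × A =>
        Y - (2 * w.1) • (1 : Matrix (Fin N) (Fin N) ℝ) := by fun_prop
    have hv : Continuous fun w : ℝ × EuclideanSpace ℝ (Fin N) × A => (w.2.1 - x).ofLp := by
      fun_prop
    have hq : Continuous fun w : ℝ × EuclideanSpace ℝ (Fin N) × A =>
        p.ofLp + (Y - (2 * w.1) • (1 : Matrix (Fin N) (Fin N) ℝ)).mulVec (w.2.1 - x).ofLp :=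
      continuous_const.add (hY'.matrix_mulVec hv)
    have hfo : Continuous fun w : ℝ × EuclideanSpace ℝ (Fin N) × A => (f w.2.1 w.2.2).ofLp := by
      fun_prop
    exact (hq.dotProduct hfo).neg.sub
      (((hσ'.matrix_mul hσ'.matrix_transpose).const_smul (1/2 : ℝ)).matrix_mul hY').matrix_trace
  have hG0 : ∀ α, G (0, x, α) = -dotP p (f x α) - (aMat (σ x α) * Y).trace := fun α => by
    simp [G, quadPolyGrad]
  choose z hz α hα using fun k : ℕ => exists_near_supersolution hV0 hlsc hV hx hpY.1 hsub
    (Nat.one_div_pos_of_nat (α := ℝ) (n := k))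
  obtain ⟨β, -, φ, hφ, hβ⟩ := isCompact_univ.tendsto_subseq (x := α) fun k => Set.mem_univ _
  have hε : Tendsto (fun k : ℕ => 1 / ((k : ℝ) + 1)) atTop (𝓝 0) :=
    tendsto_one_div_add_atTop_nhds_zero_nat
  have hzx : Tendsto z atTop (𝓝 x) := by
    rw [tendsto_iff_norm_sub_tendsto_zero]
    exact squeeze_zero (fun _ => norm_nonneg _) (fun k => (hz k).le) hε
  have hlim : Tendsto (fun k => G (1 / ((φ k : ℝ) + 1), z (φ k), α (φ k))) atTop
      (𝓝 (G (0, x, β))) :=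
    (hG.tendsto _).comp ((hε.comp hφ.tendsto_atTop).prodMk_nhds
      ((hzx.comp hφ.tendsto_atTop).prodMk_nhds hβ))
  have hβ0 : 0 ≤ G (0, x, β) := ge_of_tendsto' hlim fun k => hα (φ k)
  have hbdd : BddAbove (Set.range fun α => G (0, x, α)) :=
    (isCompact_range (by fun_prop : Continuous fun α => G (0, x, α))).bddAbove
  simp only [← hG0]
  exact hβ0.trans (le_ciSup hbdd β)
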